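/- arXiv:math/0601061 — 2 statements merged into one kernel-verified Lean document; each statement's English description precedes it below -/
import Mathlib

section
/- Let M be a monoid with a surjective monoid homomorphism φ : X* → M from the free monoid on a finite alphabet X. Let X ⊔ X be the disjoint union of two copies of X and let Φ : (X ⊔ X)* → M × M be the surjective monoid homomorphism sending a letter x in the first copy to (φ(x), 1) and a letter x in the second copy to (1, φ(x)). Then the following are equivalent: (a) for every finite alphabet Σ and all languages L₁, L₂ ⊆ Σ* that are rational transductions of φ⁻¹({1}), the intersection L₁ ∩ L₂ is a rational transduction of φ⁻¹({1}); (b) the identity language Φ⁻¹({1}) of M × M is a rational transduction of φ⁻¹({1}). -/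
/-- `K ⊆ B*` is a rational transduction of `L ⊆ A*` (Nivat's characterization):
there are a finite alphabet `Z`, a regular language `R ⊆ Z*` and monoid
homomorphisms `α : Z* → A*`, `β : Z* → B*` with `K = β(α⁻¹(L) ∩ R)`. -/
def IsRatTransOf {A B : Type*} (L : Set (FreeMonoid A)) (K : Set (FreeMonoid B)) : Prop :=
  ∃ (Z : Type) (_ : Fintype Z) (R : Language Z)
    (α : FreeMonoid Z →* FreeMonoid A) (β : FreeMonoid Z →* FreeMonoid B),
    R.IsRegular ∧ K = β '' (α ⁻¹' L ∩ (R : Set (FreeMonoid Z)))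

/-- A monoid homomorphism of free monoids is a `flatMap`. -/
theorem fm_hom_eq {A B : Type*} (f : FreeMonoid A →* FreeMonoid B) (u : FreeMonoid A) :
    (f u).toList = u.toList.flatMap (fun a => (f (FreeMonoid.of a)).toList) := by
  induction u using FreeMonoid.inductionOn' with
  | one => simp
  | of_mul a u ih => simp [FreeMonoid.toList_mul, ih]

/-- Inverse homomorphic images of regular languages are regular. -/
theorem regular_comap {Y Z : Type} (f : FreeMonoid Y →* FreeMonoid Z) {R : Language Z}
    (hR : R.IsRegular) :
    Language.IsRegular (T := Y) {w : List Y | (f (FreeMonoid.ofList w)).toList ∈ R} := by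
  obtain ⟨σ, hσ, D, rfl⟩ := hR
  let E : DFA Y σ := ⟨fun s y => D.evalFrom s (f (FreeMonoid.of y)).toList, D.start, D.accept⟩
  have key : ∀ (w : List Y) (s : σ),
      E.evalFrom s w = D.evalFrom s (f (FreeMonoid.ofList w)).toList := by
    intro w
    induction w with
    | nil => intro s; simp
    | cons a w ih =>
      intro s
      rw [DFA.evalFrom_cons, ih, FreeMonoid.ofList_cons, map_mul, FreeMonoid.toList_mul,
        DFA.evalFrom_of_append]
  refine ⟨σ, hσ, E, ?_⟩
  ext w
  change E.evalFrom D.start w ∈ D.accept ↔ D.evalFrom D.start _ ∈ D.accept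
  rw [key]

/-- The automaton recognising (greedy interleavings of) pairs with equal images;
the state is the part of the first image not yet matched by the second. -/
def pbNFA {Z₁ Z₂ S : Type} (f₁ : Z₁ → List S) (f₂ : Z₂ → List S) (N : ℕ) :
    NFA (Z₁ ⊕ Z₂) {s : List S // s.length ≤ N} where
  step s a := {t | Sum.elim (fun z => t.1 = s.1 ++ f₁ z) (fun z => s.1 = f₂ z ++ t.1) a}
  start := {s | s.1 = []}
  accept := {s | s.1 = []}

theorem nfa_acc_cons {A σ : Type} (M : NFA A σ) (s : σ) (a : A) (w : List A) :
    a :: w ∈ M.acceptsFrom {s} ↔ ∃ t ∈ M.step s a, w ∈ M.acceptsFrom {t} := by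
  rw [NFA.cons_mem_acceptsFrom, NFA.stepSet_singleton, NFA.mem_acceptsFrom]
  simp only [NFA.mem_acceptsFrom]
  constructor
  · rintro ⟨q, hq, h⟩
    rw [NFA.mem_evalFrom_iff_exists] at h
    obtain ⟨t, ht, h⟩ := h
    exact ⟨t, ht, q, hq, h⟩
  · rintro ⟨t, ht, q, hq, h⟩
    exact ⟨q, hq, NFA.mem_evalFrom_iff_exists.2 ⟨t, ht, h⟩⟩

def prL {Z₁ Z₂ : Type} : Z₁ ⊕ Z₂ → List Z₁ := Sum.elim (fun z => [z]) (fun _ => [])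
def prR {Z₁ Z₂ : Type} : Z₁ ⊕ Z₂ → List Z₂ := Sum.elim (fun _ => []) (fun z => [z])

theorem pb_sound {Z₁ Z₂ S : Type} (f₁ : Z₁ → List S) (f₂ : Z₂ → List S) (N : ℕ)
    (w : List (Z₁ ⊕ Z₂)) : ∀ s, w ∈ (pbNFA f₁ f₂ N).acceptsFrom {s} →
      s.1 ++ (w.flatMap prL).flatMap f₁ = (w.flatMap prR).flatMap f₂ := by
  induction w with
  | nil =>
    intro s h
    rw [NFA.nil_mem_acceptsFrom] at h
    obtain ⟨t, rfl, ht⟩ := h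
    replace ht : t.1 = [] := ht
    simpa using ht
  | cons a w ih =>
    intro s h
    rw [nfa_acc_cons] at h
    obtain ⟨t, ht, h⟩ := h
    have := ih t h
    rcases a with z | z
    · replace ht : t.1 = s.1 ++ f₁ z := ht
      simp [prL, prR, ht] at this ⊢
      exact this
    · replace ht : s.1 = f₂ z ++ t.1 := ht
      simp [prL, prR, ht] at this ⊢
      exact this

theorem pb_complete {Z₁ Z₂ S : Type} (f₁ : Z₁ → List S) (f₂ : Z₂ → List S) (N₁ N₂ : ℕ)
    (h₁ : ∀ z, (f₁ z).length ≤ N₁) (h₂ : ∀ z, (f₂ z).length ≤ N₂) (n : ℕ) :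
    ∀ (u : List Z₁) (v : List Z₂), u.length + v.length = n →
      ∀ s : {s : List S // s.length ≤ N₂ + N₁}, s.1 ++ u.flatMap f₁ = v.flatMap f₂ →
      ∃ w ∈ (pbNFA f₁ f₂ (N₂ + N₁)).acceptsFrom {s}, w.flatMap prL = u ∧ w.flatMap prR = v := by
  induction n with
  | zero =>
    intro u v hn s h
    have hu : u = [] := List.length_eq_zero_iff.1 (by omega)
    have hv : v = [] := List.length_eq_zero_iff.1 (by omega)
    subst hu hv
    refine ⟨[], ?_, rfl, rfl⟩
    rw [NFA.nil_mem_acceptsFrom]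
    have h0 : s.1 = [] := by simpa using h
    exact ⟨s, rfl, h0⟩
  | succ n ih =>
    intro u v hn s h
    have push : s.1.length ≤ N₂ → u ≠ [] →
        ∃ w ∈ (pbNFA f₁ f₂ (N₂ + N₁)).acceptsFrom {s},
          w.flatMap prL = u ∧ w.flatMap prR = v := by
      intro hs hu
      obtain ⟨z, u, rfl⟩ := List.exists_cons_of_ne_nil hu
      obtain ⟨w, hw, e₁, e₂⟩ := ih u v (by simp at hn; omega)
        ⟨s.1 ++ f₁ z, by have := h₁ z; simp; omega⟩ (by simpa using h)
      refine ⟨Sum.inl z :: w, ?_, by simp [prL, ← e₁], by simp [prR, ← e₂]⟩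
      rw [nfa_acc_cons]
      exact ⟨_, rfl, hw⟩
    have pop : ∀ z v', v = z :: v' → (f₂ z).length ≤ s.1.length →
        ∃ w ∈ (pbNFA f₁ f₂ (N₂ + N₁)).acceptsFrom {s},
          w.flatMap prL = u ∧ w.flatMap prR = v := by
      rintro z v' rfl hl
      have hp : f₂ z <+: s.1 := by
        refine List.prefix_of_prefix_length_le (l₃ := s.1 ++ u.flatMap f₁) ?_
          (List.prefix_append _ _) hl
        rw [h, List.flatMap_cons]
        exact List.prefix_append _ _
      obtain ⟨t, ht⟩ := hp
      obtain ⟨w, hw, e₁, e₂⟩ := ih u v' (by simp at hn; omega)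
        ⟨t, by have := s.2; rw [← ht] at this; simp at this; omega⟩ (by
          rw [← ht, List.flatMap_cons, List.append_assoc] at h
          exact List.append_cancel_left h)
      refine ⟨Sum.inr z :: w, ?_, by simp [prL, ← e₁], by simp [prR, ← e₂]⟩
      rw [nfa_acc_cons]
      exact ⟨_, ht.symm, hw⟩
    rcases v with _ | ⟨z, v'⟩
    · apply push
      · have : s.1 = [] := by simp at h; exact h.1
        simp [this]
      · rintro rfl
        simp at hn
    · by_cases hl : (f₂ z).length ≤ s.1.length
      · exact pop z v' rfl hl
      · apply push
        · have := h₂ z; omega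
        · rintro rfl
          apply hl
          simp at h
          simp [h]

/-- The pullback of two homomorphisms of finitely generated free monoids is rational. -/
theorem pullback_rational {Z₁ Z₂ S : Type} [Fintype Z₁] [Fintype Z₂] [Finite S]
    (β₁ : FreeMonoid Z₁ →* FreeMonoid S) (β₂ : FreeMonoid Z₂ →* FreeMonoid S) :
    ∃ (R : Language (Z₁ ⊕ Z₂)) (π₁ : FreeMonoid (Z₁ ⊕ Z₂) →* FreeMonoid Z₁)
      (π₂ : FreeMonoid (Z₁ ⊕ Z₂) →* FreeMonoid Z₂), R.IsRegular ∧
      (∀ w ∈ R, β₁ (π₁ (FreeMonoid.ofList w)) = β₂ (π₂ (FreeMonoid.ofList w))) ∧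
      ∀ u v, β₁ u = β₂ v → ∃ w ∈ R, π₁ (FreeMonoid.ofList w) = u ∧
        π₂ (FreeMonoid.ofList w) = v := by
  let f₁ : Z₁ → List S := fun z => (β₁ (FreeMonoid.of z)).toList
  let f₂ : Z₂ → List S := fun z => (β₂ (FreeMonoid.of z)).toList
  obtain ⟨N₁, hN₁⟩ := (Set.finite_range (fun z => (f₁ z).length)).bddAbove
  obtain ⟨N₂, hN₂⟩ := (Set.finite_range (fun z => (f₂ z).length)).bddAbove
  let π₁ : FreeMonoid (Z₁ ⊕ Z₂) →* FreeMonoid Z₁ :=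
    FreeMonoid.lift (fun a => FreeMonoid.ofList (prL a))
  let π₂ : FreeMonoid (Z₁ ⊕ Z₂) →* FreeMonoid Z₂ :=
    FreeMonoid.lift (fun a => FreeMonoid.ofList (prR a))
  have hπ₁ : ∀ w : List (Z₁ ⊕ Z₂), (π₁ (FreeMonoid.ofList w)).toList = w.flatMap prL := by
    intro w; rw [fm_hom_eq]; simp [π₁]
  have hπ₂ : ∀ w : List (Z₁ ⊕ Z₂), (π₂ (FreeMonoid.ofList w)).toList = w.flatMap prR := by
    intro w; rw [fm_hom_eq]; simp [π₂]
  let s₀ : {s : List S // s.length ≤ N₂ + N₁} := ⟨[], by simp⟩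
  have hst : (pbNFA f₁ f₂ (N₂ + N₁)).start = {s₀} := by
    ext s
    exact (Subtype.ext_iff (a1 := s) (a2 := s₀)).symm
  refine ⟨(pbNFA f₁ f₂ (N₂ + N₁)).accepts, π₁, π₂, ?_, ?_, ?_⟩
  · rw [← NFA.toDFA_correct]
    have : Finite {s : List S // s.length ≤ N₂ + N₁} :=
      (List.finite_length_le S (N₂ + N₁)).to_subtype
    exact ⟨_, Fintype.ofFinite _, _, rfl⟩
  · intro w hw
    rw [NFA.accepts_eq_acceptsFrom_start, hst] at hw
    have := pb_sound f₁ f₂ _ w _ hw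
    apply FreeMonoid.toList.injective
    rw [fm_hom_eq, fm_hom_eq β₂, hπ₁, hπ₂]
    simpa [s₀] using this
  · intro u v huv
    obtain ⟨w, hw, e₁, e₂⟩ := pb_complete f₁ f₂ N₁ N₂ (fun z => hN₁ ⟨z, rfl⟩)
      (fun z => hN₂ ⟨z, rfl⟩) _ u.toList v.toList rfl s₀ (by
        have := congrArg FreeMonoid.toList huv
        rw [fm_hom_eq, fm_hom_eq β₂] at this
        simpa [s₀] using this)
    refine ⟨w, ?_, ?_, ?_⟩
    · rw [NFA.accepts_eq_acceptsFrom_start, hst]; exact hw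
    · apply FreeMonoid.toList.injective; rw [hπ₁, e₁]
    · apply FreeMonoid.toList.injective; rw [hπ₂, e₂]

/-- Rational transductions compose. -/
theorem IsRatTransOf.comp {A B C : Type*} {D : Type} [Finite D] (e : B ≃ D)
    {L : Set (FreeMonoid A)} {K : Set (FreeMonoid B)}
    {J : Set (FreeMonoid C)} (h : IsRatTransOf L K) (h' : IsRatTransOf K J) :
    IsRatTransOf L J := by
  obtain ⟨Z, _, R, α, β, hR, rfl⟩ := h
  obtain ⟨Z', _, R', α', β', hR', rfl⟩ := h'
  let E : FreeMonoid B ≃* FreeMonoid D := FreeMonoid.freeMonoidCongr e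
  obtain ⟨S, π₁, π₂, hS, hs, hc⟩ := pullback_rational
    (E.toMonoidHom.comp β) (E.toMonoidHom.comp α')
  refine ⟨Z ⊕ Z', inferInstance, _, α.comp π₁, β'.comp π₂,
    hS.inf ((regular_comap π₁ hR).inf (regular_comap π₂ hR')), ?_⟩
  ext x
  constructor
  · rintro ⟨v, ⟨⟨u, ⟨hu, huR⟩, huv⟩, hv⟩, rfl⟩
    obtain ⟨w, hw, rfl, rfl⟩ := hc u v (congrArg E huv)
    exact ⟨FreeMonoid.ofList w, ⟨hu, hw, huR, hv⟩, rfl⟩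
  · rintro ⟨w, ⟨hu, hw, huR, hv⟩, rfl⟩
    exact ⟨π₂ w, ⟨⟨π₁ w, ⟨hu, huR⟩, E.injective (hs _ hw)⟩, hv⟩, rfl⟩


/-- The class of rational transductions of the identity language of `M` is
closed under (binary, hence finite) intersection iff the identity language of
`M × M` is a rational transduction of the identity language of `M`. -/
theorem inter_closed_iff_identityLanguage_prod_ratTrans
    {M : Type*} [Monoid M] {X : Type} [Fintype X]
    (φ : FreeMonoid X →* M) (hφ : Function.Surjective φ) :
    (∀ (Sg : Type) [Fintype Sg] (L₁ L₂ : Set (FreeMonoid Sg)),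
        IsRatTransOf (φ ⁻¹' {1}) L₁ → IsRatTransOf (φ ⁻¹' {1}) L₂ →
          IsRatTransOf (φ ⁻¹' {1}) (L₁ ∩ L₂)) ↔
      IsRatTransOf (φ ⁻¹' {1})
        ((FreeMonoid.lift
            (Sum.elim (fun x : X => ((φ (FreeMonoid.of x), 1) : M × M))
              (fun x : X => ((1, φ (FreeMonoid.of x)) : M × M)))
          : FreeMonoid (X ⊕ X) →* M × M) ⁻¹' {1}) := by
  classical
  set Φ : FreeMonoid (X ⊕ X) →* M × M := FreeMonoid.lift
            (Sum.elim (fun x : X => ((φ (FreeMonoid.of x), 1) : M × M))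
              (fun x : X => ((1, φ (FreeMonoid.of x)) : M × M))) with hΦ
  constructor
  · intro H
    let p₁ : FreeMonoid (X ⊕ X) →* FreeMonoid X :=
      FreeMonoid.lift (Sum.elim FreeMonoid.of (fun _ => 1))
    let p₂ : FreeMonoid (X ⊕ X) →* FreeMonoid X :=
      FreeMonoid.lift (Sum.elim (fun _ => 1) FreeMonoid.of)
    have hp : Φ = (φ.comp p₁).prod (φ.comp p₂) := by
      apply FreeMonoid.hom_eq
      rintro (x | x) <;> simp [Φ, p₁, p₂]
    have huniv : (⊤ : Language (X ⊕ X)).IsRegular :=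
      ⟨Unit, inferInstance, ⟨fun _ _ => (), (), Set.univ⟩, by
        ext w; exact ⟨fun _ => trivial, fun _ => trivial⟩⟩
    have key : ∀ p : FreeMonoid (X ⊕ X) →* FreeMonoid X,
        IsRatTransOf (φ ⁻¹' {1}) (p ⁻¹' (φ ⁻¹' {1})) := by
      intro p
      refine ⟨X ⊕ X, inferInstance, ⊤, p, MonoidHom.id _, huniv, ?_⟩
      ext w
      constructor
      · intro hw
        exact ⟨w, ⟨hw, trivial⟩, rfl⟩
      · rintro ⟨w, ⟨hw, -⟩, rfl⟩
        exact hw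
    have := H (X ⊕ X) _ _ (key p₁) (key p₂)
    convert this using 1
    ext w
    simp [hp, Prod.ext_iff]
  · intro H Sg _ L₁ L₂ h₁ h₂
    refine IsRatTransOf.comp (Equiv.refl (X ⊕ X)) H ?_
    obtain ⟨Z₁, _, R₁, α₁, β₁, hR₁, rfl⟩ := h₁
    obtain ⟨Z₂, _, R₂, α₂, β₂, hR₂, rfl⟩ := h₂
    obtain ⟨S, π₁, π₂, hS, hs, hc⟩ := pullback_rational β₁ β₂
    let α : FreeMonoid (Z₁ ⊕ Z₂) →* FreeMonoid (X ⊕ X) := FreeMonoid.lift fun z =>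
      FreeMonoid.map Sum.inl (α₁ (π₁ (FreeMonoid.of z))) *
        FreeMonoid.map Sum.inr (α₂ (π₂ (FreeMonoid.of z)))
    have hl : ∀ u : FreeMonoid X, Φ (FreeMonoid.map Sum.inl u) = (φ u, 1) := by
      intro u
      have : Φ.comp (FreeMonoid.map Sum.inl) = φ.prod 1 := by
        apply FreeMonoid.hom_eq
        intro x; simp [Φ]
      exact DFunLike.congr_fun this u
    have hr : ∀ u : FreeMonoid X, Φ (FreeMonoid.map Sum.inr u) = (1, φ u) := by
      intro u
      have : Φ.comp (FreeMonoid.map Sum.inr) = (1 : FreeMonoid X →* M).prod φ := by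
        apply FreeMonoid.hom_eq
        intro x; simp [Φ]
      exact DFunLike.congr_fun this u
    have hα : ∀ w, Φ (α w) = (φ (α₁ (π₁ w)), φ (α₂ (π₂ w))) := by
      intro w
      have : Φ.comp α = (φ.comp (α₁.comp π₁)).prod (φ.comp (α₂.comp π₂)) := by
        apply FreeMonoid.hom_eq
        intro z; simp [α, hl, hr]
      exact DFunLike.congr_fun this w
    refine ⟨Z₁ ⊕ Z₂, inferInstance, _, α, β₁.comp π₁,
      hS.inf ((regular_comap π₁ hR₁).inf (regular_comap π₂ hR₂)), ?_⟩
    ext x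
    constructor
    · rintro ⟨⟨u, ⟨hu, huR⟩, rfl⟩, ⟨v, ⟨hv, hvR⟩, huv⟩⟩
      obtain ⟨w, hw, rfl, rfl⟩ := hc u v huv.symm
      refine ⟨FreeMonoid.ofList w, ⟨?_, hw, huR, hvR⟩, rfl⟩
      change Φ (α _) = 1
      rw [hα]
      exact Prod.ext hu hv
    · rintro ⟨w, ⟨hu, hw, huR, hvR⟩, rfl⟩
      replace hu : Φ (α w) = 1 := hu
      rw [hα, Prod.ext_iff] at hu
      exact ⟨⟨π₁ w, ⟨hu.1, huR⟩, rfl⟩, ⟨π₂ w, ⟨hu.2, hvR⟩, (hs _ hw).symm⟩⟩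
end

section
/- Let X be a finite set, let # be a symbol not in X, and write X# = X ∪ {#}. For a word w ∈ X̄*, the following are equivalent: (i) w belongs to the one-sided Dyck language D'_X; (ii) some permissible padding of w belongs to the one-sided Dyck language D'_{X#}; (iii) some permissible padding of w represents the identity element of the free group F(X#). -/
/-- The one-sided (semi-)Dyck language over the alphabet `X × Bool`
(`(x, true)` is the positive letter `x`, `(x, false)` is `x⁻¹`): the smallest
language containing the empty word, closed under concatenation, and containing
`x·u·x⁻¹` whenever it contains `u`.  It is the identity language of the
polycyclic monoid on `X`. -/
inductive IsSemiDyck {X : Type*} : List (X × Bool) → Prop where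
  | nil : IsSemiDyck []
  | append {u v : List (X × Bool)} : IsSemiDyck u → IsSemiDyck v → IsSemiDyck (u ++ v)
  | wrap {u : List (X × Bool)} (x : X) :
      IsSemiDyck u → IsSemiDyck ((x, true) :: (u ++ [(x, false)]))

/-- The positive letter `#` over the padded alphabet `X# = X ⊕ Unit`. -/
def hashLetter (X : Type*) : (X ⊕ Unit) × Bool := (Sum.inr (), true)

/-- The negative letter `#⁻¹` over the padded alphabet `X# = X ⊕ Unit`. -/
def hashInvLetter (X : Type*) : (X ⊕ Unit) × Bool := (Sum.inr (), false)

/-- The canonical inclusion of letters over `X` into letters over `X# = X ⊕ Unit`. -/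
def padEmb {X : Type*} (a : X × Bool) : (X ⊕ Unit) × Bool := (Sum.inl a.1, a.2)

/-- `p` is a permissible padding of `w = w₁⋯wₙ` if
`p = x₁x₂⋯xₙ(#⁻¹)^k` for some `k ≥ 0`, where `xᵢ = wᵢ·#` when `wᵢ` is a positive
letter and `xᵢ = (#⁻¹)^m·wᵢ·#` for some `m ≥ 0` when `wᵢ` is a negative letter. -/
def IsPermissiblePadding {X : Type*} (w : List (X × Bool))
    (p : List ((X ⊕ Unit) × Bool)) : Prop :=
  ∃ (m : List ℕ) (k : ℕ),
    List.Forall₂ (fun (a : X × Bool) (mi : ℕ) => a.2 = true → mi = 0) w m ∧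
    p = (List.zipWith
          (fun (a : X × Bool) (mi : ℕ) =>
            List.replicate mi (hashInvLetter X) ++ [padEmb a, hashLetter X]) w m).flatten
        ++ List.replicate k (hashInvLetter X)

theorem chain_sub {α : Type*} {R : α → α → Prop} {l₁ l : List α} (h : l.IsChain R)
    (hs : l₁ <:+: l) : l₁.IsChain R := by
  obtain ⟨s, t, rfl⟩ := hs
  exact h.left_of_append.right_of_append

/-- The padded word without the trailing block of `#⁻¹`. -/
inductive PadCore {X : Type*} : List (X × Bool) → List ((X ⊕ Unit) × Bool) → Prop where
  | nil : PadCore [] []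
  | cons {w q} (a : X × Bool) (m : ℕ) (h : a.2 = true → m = 0) : PadCore w q →
      PadCore (a :: w) (List.replicate m (hashInvLetter X) ++ padEmb a :: hashLetter X :: q)

theorem PadCore.append {X : Type*} {w w' : List (X × Bool)} {q q'}
    (h : PadCore w q) (h' : PadCore w' q') : PadCore (w ++ w') (q ++ q') := by
  induction h with
  | nil => simpa using h'
  | cons a m h _ ih => simpa using PadCore.cons a m h ih

theorem permissible_iff {X : Type*} (w : List (X × Bool)) (p) :
    IsPermissiblePadding w p ↔
      ∃ q k, PadCore w q ∧ p = q ++ List.replicate k (hashInvLetter X) := by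
  constructor
  · rintro ⟨m, k, h, rfl⟩
    refine ⟨_, k, ?_, rfl⟩
    induction h with
    | nil => exact PadCore.nil
    | cons h _ ih => simpa using PadCore.cons _ _ h ih
  · rintro ⟨q, k, h, rfl⟩
    have : ∃ m : List ℕ,
        List.Forall₂ (fun (a : X × Bool) (mi : ℕ) => a.2 = true → mi = 0) w m ∧
        q = (List.zipWith (fun (a : X × Bool) (mi : ℕ) =>
          List.replicate mi (hashInvLetter X) ++ [padEmb a, hashLetter X]) w m).flatten := by
      induction h with
      | nil => exact ⟨[], by simp, by simp⟩
      | cons a m h _ ih =>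
        obtain ⟨ms, h1, h2⟩ := ih
        exact ⟨m :: ms, List.Forall₂.cons h h1, by simp [← h2]⟩
    obtain ⟨m, h1, rfl⟩ := this
    exact ⟨m, k, h1, rfl⟩

theorem IsSemiDyck.insert {X : Type*} {s v : List (X × Bool)} (hs : IsSemiDyck s)
    (hv : IsSemiDyck v) : ∀ a b, s = a ++ b → IsSemiDyck (a ++ (v ++ b)) := by
  induction hs with
  | nil =>
    intro a b h
    obtain ⟨rfl, rfl⟩ := List.append_eq_nil_iff.1 h.symm
    simpa using hv
  | @append u u' h1 h2 ih1 ih2 =>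
    intro a b h
    rcases List.append_eq_append_iff.1 h with ⟨c, rfl, h'⟩ | ⟨c, h', rfl⟩
    · simpa using h1.append (ih2 _ _ h')
    · simpa using (ih1 _ _ h').append h2
  | @wrap u x hu ih =>
    intro a b h
    cases a with
    | nil =>
      simp only [List.nil_append] at h ⊢
      subst h
      exact hv.append (hu.wrap x)
    | cons y a =>
      simp only [List.cons_append, List.cons.injEq] at h
      obtain ⟨rfl, h⟩ := h
      rcases List.eq_nil_or_concat b with rfl | ⟨b, z, rfl⟩
      · simp only [List.append_nil] at h
        subst h
        simpa using (hu.wrap x).append hv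
      · simp only [List.concat_eq_append] at h ⊢
        rw [← List.append_assoc] at h
        obtain ⟨h1, h2⟩ := List.append_inj' h rfl
        simp only [List.cons.injEq, and_true] at h2
        subst h2
        simpa using (ih _ _ h1).wrap x

theorem IsSemiDyck.exists_core {X : Type*} {w : List (X × Bool)} (hw : IsSemiDyck w) :
    ∃ q k, PadCore w q ∧ IsSemiDyck (q ++ List.replicate k (hashInvLetter X)) := by
  induction hw with
  | nil => exact ⟨[], 0, PadCore.nil, by simpa using IsSemiDyck.nil⟩
  | append _ _ ih1 ih2 =>
    obtain ⟨q1, k1, c1, d1⟩ := ih1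
    obtain ⟨q2, k2, c2, d2⟩ := ih2
    refine ⟨q1 ++ q2, k2 + k1, c1.append c2, ?_⟩
    have := d1.insert d2 _ _ rfl
    rw [List.replicate_add]
    simpa only [List.append_assoc] using this
  | wrap x _ ih =>
    obtain ⟨q, k, c, d⟩ := ih
    refine ⟨_, 1, PadCore.cons (x, true) 0 (by simp)
      (c.append (PadCore.cons (x, false) (k + 1) (by simp) PadCore.nil)), ?_⟩
    have h1 := (d.wrap (Sum.inr ())).wrap (Sum.inl x)
    have h2 := h1.append (IsSemiDyck.nil.wrap (Sum.inr ()))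
    have e : List.replicate (k + 1) (hashInvLetter X) =
        List.replicate k (hashInvLetter X) ++ [hashInvLetter X] := List.replicate_succ'
    rw [e]
    simpa only [List.replicate_zero, List.replicate_one, List.nil_append, List.append_assoc,
      List.cons_append, hashLetter, hashInvLetter, padEmb] using h2

theorem IsSemiDyck.mk_eq_one {X : Type*} {w : List (X × Bool)} (hw : IsSemiDyck w) :
    FreeGroup.mk w = 1 := by
  induction hw with
  | nil => rfl
  | append _ _ h1 h2 => rw [← FreeGroup.mul_mk, h1, h2, one_mul]
  | @wrap u x _ h =>
    have e : (x, true) :: (u ++ [(x, false)]) = [(x, true)] ++ (u ++ [(x, false)]) := rfl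
    rw [e, ← FreeGroup.mul_mk, ← FreeGroup.mul_mk, h, one_mul, FreeGroup.mul_mk]
    exact Quot.sound (FreeGroup.Red.Step.not (L₁ := []) (L₂ := []) (x := x) (b := true))

theorem IsSemiDyck.decomp {X : Type*} {w : List (X × Bool)} (hw : IsSemiDyck w) :
    w = [] ∨ ∃ u x v, IsSemiDyck u ∧ IsSemiDyck v ∧
      w = u ++ (x, true) :: (v ++ [(x, false)]) := by
  induction hw with
  | nil => exact Or.inl rfl
  | @append u v hu hv h1 h2 =>
    rcases h2 with rfl | ⟨u', x, v', d1, d2, rfl⟩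
    · simpa using h1
    · exact Or.inr ⟨u ++ u', x, v', hu.append d1, d2, by simp⟩
  | @wrap u x hu _ => exact Or.inr ⟨[], x, u, IsSemiDyck.nil, hu, by simp⟩

/-- `p` is Dyck-factored with remaining letters `r`. -/
inductive DyckDecomp {Y : Type*} : List (Y × Bool) → List (Y × Bool) → Prop where
  | base {d} : IsSemiDyck d → DyckDecomp d []
  | step {d p r} (a : Y × Bool) : IsSemiDyck d → DyckDecomp p r →
      DyckDecomp (d ++ a :: p) (a :: r)

theorem DyckDecomp.mk_eq {Y : Type*} {p r : List (Y × Bool)} (h : DyckDecomp p r) :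
    FreeGroup.mk p = FreeGroup.mk r := by
  induction h with
  | base h => exact h.mk_eq_one
  | @step d p r a hd _ ih =>
    rw [← FreeGroup.mul_mk, hd.mk_eq_one, one_mul]
    change FreeGroup.mk ([a] ++ p) = FreeGroup.mk ([a] ++ r)
    rw [← FreeGroup.mul_mk, ← FreeGroup.mul_mk, ih]

theorem DyckDecomp.prepend {Y : Type*} {e p r : List (Y × Bool)} (he : IsSemiDyck e)
    (h : DyckDecomp p r) : DyckDecomp (e ++ p) r := by
  cases h with
  | base h => exact .base (he.append h)
  | step a hd h' => rw [← List.append_assoc]; exact .step a (he.append hd) h'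

theorem exists_decomp {Y : Type*} (p : List (Y × Bool))
    (hp : ∀ y u, IsSemiDyck u → ¬ ((y, false) :: (u ++ [(y, true)])) <:+: p) :
    ∃ r, DyckDecomp p r ∧ FreeGroup.IsReduced r := by
  induction p with
  | nil => exact ⟨[], .base .nil, by simp⟩
  | cons a p ih =>
    obtain ⟨r, hr, hred⟩ := ih fun y u hu h => hp y u hu (h.trans (List.suffix_cons a p).isInfix)
    cases hr with
    | base h => exact ⟨[a], .step (d := []) a .nil (.base h), by simp⟩
    | @step d p r b hd h' =>
      by_cases hab : a.1 = b.1 → a.2 = b.2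
      · refine ⟨a :: b :: r, .step (d := []) a .nil (.step b hd h'), ?_⟩
        rw [FreeGroup.isReduced_cons_cons]
        exact ⟨hab, hred⟩
      · obtain ⟨x, s⟩ := a
        obtain ⟨y, t⟩ := b
        push Not at hab
        obtain ⟨h1, h2⟩ := hab
        simp only at h1 h2
        subst h1
        cases s <;> cases t <;> simp at h2
        · exact (hp x d hd ⟨[], p, by simp⟩).elim
        · refine ⟨r, ?_, ?_⟩
          · have := DyckDecomp.prepend (hd.wrap x) h'
            simpa using this
          · exact chain_sub hred (List.suffix_cons _ r).isInfix

theorem dyck_of_mk_eq_one {Y : Type*} (p : List (Y × Bool))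
    (hp : ∀ y u, IsSemiDyck u → ¬ ((y, false) :: (u ++ [(y, true)])) <:+: p)
    (h1 : FreeGroup.mk p = 1) : IsSemiDyck p := by
  obtain ⟨r, hr, hred⟩ := exists_decomp p hp
  have : r = [] := by
    classical
    rw [hr.mk_eq] at h1
    have h2 := congrArg FreeGroup.toWord h1
    rwa [FreeGroup.toWord_mk, FreeGroup.toWord_one, hred.reduce_eq] at h2
  subst this
  cases hr
  assumption

/-- Local constraint satisfied by adjacent letters of a permissible padding. -/
def PadAdj {X : Type*} (a b : (X ⊕ Unit) × Bool) : Prop :=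
  (b = hashLetter X → a.1.isLeft = true) ∧ (∀ x, b = (Sum.inl x, true) → a.2 = true)

theorem chain_replicate {X : Type*} (k : ℕ) (a : (X ⊕ Unit) × Bool) :
    List.IsChain PadAdj (a :: List.replicate k (hashInvLetter X)) := by
  induction k generalizing a with
  | zero => simp
  | succ k ih =>
    rw [List.replicate_succ, List.isChain_cons_cons]
    exact ⟨by simp [PadAdj, hashInvLetter, hashLetter], ih _⟩

theorem chain_replicate_append {X : Type*} (m : ℕ) (x : X) (a : (X ⊕ Unit) × Bool) (l)
    (h : List.IsChain PadAdj ((Sum.inl x, false) :: l)) :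
    List.IsChain PadAdj (a :: (List.replicate m (hashInvLetter X) ++ (Sum.inl x, false) :: l)) := by
  induction m generalizing a with
  | zero =>
    simp only [List.replicate_zero, List.nil_append, List.isChain_cons_cons]
    exact ⟨by simp [PadAdj, hashLetter], h⟩
  | succ k ih =>
    rw [List.replicate_succ, List.cons_append, List.isChain_cons_cons]
    exact ⟨by simp [PadAdj, hashInvLetter, hashLetter], ih _⟩

theorem PadCore.chain {X : Type*} {w : List (X × Bool)} {q} (h : PadCore w q) (k : ℕ) :
    List.IsChain PadAdj (hashLetter X :: (q ++ List.replicate k (hashInvLetter X))) := by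
  induction h with
  | nil => exact chain_replicate k _
  | cons a m h _ ih =>
    obtain ⟨x, s⟩ := a
    have h1 : List.IsChain PadAdj ((Sum.inl x, s) :: hashLetter X :: (_ ++ _)) :=
      List.isChain_cons_cons.2 ⟨by simp [PadAdj, hashLetter], ih⟩
    cases s with
    | true =>
      obtain rfl := h rfl
      simp only [List.replicate_zero, List.nil_append, List.cons_append, padEmb]
      exact List.isChain_cons_cons.2 ⟨by simp [PadAdj, hashLetter], h1⟩
    | false =>
      have := chain_replicate_append m x (hashLetter X) _ h1
      simpa [padEmb] using this

theorem no_bad_factor {X : Type*} {p : List ((X ⊕ Unit) × Bool)} (hc : List.IsChain PadAdj p)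
    (y u) (hu : IsSemiDyck u) : ¬ ((y, false) :: (u ++ [(y, true)])) <:+: p := by
  intro hin
  have hc := chain_sub hc hin
  -- a positive letter after a negative letter and a Dyck word is preceded by a negative letter
  have key : ∀ (z y : X ⊕ Unit) (v : List ((X ⊕ Unit) × Bool)) (t), IsSemiDyck v →
      List.IsChain PadAdj ((z, false) :: (v ++ (y, true) :: t)) → y = Sum.inr () := by
    intro z y v t hv hc
    have : ∃ z', PadAdj (z', false) (y, true) := by
      rcases hv.decomp with rfl | ⟨v1, x, v2, -, -, rfl⟩
      · exact ⟨z, (List.isChain_cons_cons.1 hc).1⟩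
      · refine ⟨x, ?_⟩
        have := chain_sub hc (l₁ := [(x, false), (y, true)])
          ⟨(z, false) :: (v1 ++ (x, true) :: v2), t, by simp⟩
        exact (List.isChain_cons_cons.1 this).1
    obtain ⟨z', -, h⟩ := this
    cases y with
    | inl x => exact absurd (h x rfl) (by simp)
    | inr x => rfl
  obtain rfl := key _ _ _ _ hu hc
  rcases hu.decomp with rfl | ⟨v1, x, v2, d1, -, rfl⟩
  · have := (List.isChain_cons_cons.1 hc).1.1 rfl
    simp at this
  · have h2 := chain_sub hc (l₁ := [(x, false), (Sum.inr (), true)])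
      ⟨(Sum.inr (), false) :: (v1 ++ (x, true) :: v2), [], by simp⟩
    have h3 := (List.isChain_cons_cons.1 h2).1.1 rfl
    have h4 : x = Sum.inr () := by
      refine key (Sum.inr ()) x v1 (v2 ++ [(x, false), (Sum.inr (), true)]) d1 ?_
      simpa using hc
    simp [h4] at h3

/-- Erase a padding letter. -/
def unpad {X : Type*} : (X ⊕ Unit) × Bool → Option (X × Bool)
  | (Sum.inl x, b) => some (x, b)
  | (Sum.inr _, _) => none

theorem unpad_inr {X : Type*} (x : Unit) (b : Bool) :
    unpad ((Sum.inr x, b) : (X ⊕ Unit) × Bool) = none := rfl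

theorem unpad_inl {X : Type*} (x : X) (b : Bool) :
    unpad ((Sum.inl x, b) : (X ⊕ Unit) × Bool) = some (x, b) := rfl

theorem unpad_replicate {X : Type*} (k : ℕ) :
    (List.replicate k (hashInvLetter X)).filterMap unpad = [] := by
  induction k with
  | zero => rfl
  | succ k ih =>
    rw [List.replicate_succ, List.filterMap_cons_none (a := hashInvLetter X) rfl, ih]

theorem IsSemiDyck.unpad {X : Type*} {p : List ((X ⊕ Unit) × Bool)} (h : IsSemiDyck p) :
    IsSemiDyck (p.filterMap unpad) := by
  induction h with
  | nil => exact .nil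
  | append _ _ h1 h2 => rw [List.filterMap_append]; exact h1.append h2
  | wrap x _ h =>
    cases x with
    | inl x => simpa [List.filterMap_cons, unpad_inl] using h.wrap x
    | inr x => simpa [List.filterMap_cons, unpad_inr] using h

theorem PadCore.unpad {X : Type*} {w : List (X × Bool)} {q} (h : PadCore w q) :
    q.filterMap unpad = w := by
  induction h with
  | nil => rfl
  | cons a m _ _ ih =>
    simp [List.filterMap_cons, unpad_replicate, unpad_inl, unpad_inr, hashLetter, padEmb, ih]

/-- For a word `w` over `X̄`, the following are equivalent: (i) `w` lies in the
one-sided Dyck language over `X`; (ii) some permissible padding of `w` lies in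
the one-sided Dyck language over `X# = X ⊕ Unit`; (iii) some permissible padding
of `w` represents the identity of the free group `F(X#)`. -/
theorem semiDyck_iff_permissiblePadding
    {X : Type} [Fintype X] (w : List (X × Bool)) :
    List.TFAE
      [IsSemiDyck w,
       ∃ p, IsPermissiblePadding w p ∧ IsSemiDyck p,
       ∃ p, IsPermissiblePadding w p ∧ FreeGroup.mk p = 1] := by
  tfae_have 1 → 2 := by
    intro h
    obtain ⟨q, k, c, d⟩ := h.exists_core
    exact ⟨_, (permissible_iff _ _).2 ⟨q, k, c, rfl⟩, d⟩
  tfae_have 2 → 3 := fun ⟨p, h, d⟩ => ⟨p, h, d.mk_eq_one⟩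
  tfae_have 3 → 1 := by
    rintro ⟨p, h, h1⟩
    obtain ⟨q, k, c, rfl⟩ := (permissible_iff _ _).1 h
    have hc := chain_sub (c.chain k) (List.suffix_cons _ _).isInfix
    have := (dyck_of_mk_eq_one _ (no_bad_factor hc) h1).unpad
    simpa [c.unpad, unpad_replicate] using this
  tfae_finish
end
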